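/- Define f(α) := (2/5)·min(α, 1−α). Let q ≥ 2 be an integer, let α be a real number with 0 < α < (q−1)/q, set d := ⌊qα⌋ and α' := α − d/q, and suppose n is a positive integer such that n₁ := qα'n, (d+1)n₁/q, and d(n−n₁)/q are all integers (so αn is an integer). Let ε > 0 satisfy q < 2^{f(α)/ε}. Then every code C ⊆ (Fin q)^n in which no two distinct codewords have a common subsequence of length at least n − αn (i.e., C is uniquely decodable from αn deletions, and hence from any combination of αn total insertions and deletions) satisfies |C| ≤ 4^q · q^{n(1−α−ε)}. -/

import Mathlib

open Real

/-- In any finite set, some `k`-element subset carries at least the average share of a weight. -/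
lemma Finset.exists_subset_card_eq_mul_sum_le {ι : Type*} [DecidableEq ι] (c : ι → ℕ) (k : ℕ)
    (A : Finset ι) (hk : k ≤ A.card) :
    ∃ S ⊆ A, S.card = k ∧ k * ∑ i ∈ A, c i ≤ A.card * ∑ i ∈ S, c i := by
  induction A using Finset.strongInduction with
  | H A ih =>
    rcases hk.eq_or_lt with h | h
    · exact ⟨A, subset_rfl, h.symm, by rw [h]⟩
    have hA : A.Nonempty := Finset.card_pos.mp (by omega)
    obtain ⟨a, ha, hmin⟩ := A.exists_min_image c hA
    have hcard := Finset.card_erase_add_one ha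
    obtain ⟨S, hSA, hS, hsum⟩ := ih _ (Finset.erase_ssubset ha) (by omega)
    refine ⟨S, hSA.trans (Finset.erase_subset _ _), hS, ?_⟩
    have hsplit := Finset.add_sum_erase A c ha
    have hle : (A.erase a).card * c a ≤ ∑ i ∈ A.erase a, c i := by
      simpa using Finset.card_nsmul_le_sum (A.erase a) c (c a)
        fun i hi => hmin i (Finset.mem_of_mem_erase hi)
    rcases Nat.eq_zero_or_pos (A.erase a).card with h0 | hpos
    · have : k = 0 := by omega
      simp [this]
    rw [← hsplit, ← hcard]
    refine Nat.le_of_mul_le_mul_left ?_ hpos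
    set p := (A.erase a).card
    set s := ∑ i ∈ A.erase a, c i
    calc p * (k * (c a + s)) = k * (p * c a) + k * (p * s) := by ring
      _ ≤ k * s + k * (p * s) := by gcongr
      _ = (p + 1) * (k * s) := by ring
      _ ≤ (p + 1) * (p * ∑ i ∈ S, c i) := by gcongr
      _ = p * ((p + 1) * ∑ i ∈ S, c i) := by ring

lemma List.length_filter_mem_eq_sum_count {ι : Type*} [DecidableEq ι] (S : Finset ι) (x : List ι) :
    (x.filter (· ∈ S)).length = ∑ i ∈ S, x.count i := by
  induction x with
  | nil => simp
  | cons a x ih =>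
    simp only [List.count_cons, Finset.sum_add_distrib, ← ih, List.filter_cons]
    by_cases h : a ∈ S <;> simp [h]

/-- A word over `q` letters keeps a `k / q` fraction of its symbols after restriction to some
`k` letters. -/
lemma List.exists_sublist_mem_of_card_eq {q : ℕ} (x : List (Fin q)) (k m : ℕ) (hk : k ≤ q)
    (hq : 0 < q) (hm : q * m = k * x.length) :
    ∃ S : Finset (Fin q), S.card = k ∧
      ∃ v : List (Fin q), v.Sublist x ∧ v.length = m ∧ ∀ a ∈ v, a ∈ S := by
  obtain ⟨S, -, hS, hsum⟩ := Finset.exists_subset_card_eq_mul_sum_le (fun i => x.count i) k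
    (Finset.univ : Finset (Fin q)) (by simpa using hk)
  refine ⟨S, hS, (x.filter (· ∈ S)).take m,
    (List.take_sublist _ _).trans List.filter_sublist, ?_, ?_⟩
  · rw [← List.length_filter_mem_eq_sum_count, ← List.length_filter_mem_eq_sum_count] at hsum
    simp only [Finset.mem_univ, decide_true, List.filter_true, Finset.card_univ,
      Fintype.card_fin, ← hm] at hsum
    simpa using Nat.le_of_mul_le_mul_left hsum hq
  · intro a ha
    simpa using (List.mem_filter.mp (List.mem_of_mem_take ha)).2

/-- The words of length `m` all of whose letters lie in `S`. -/
def wordsOver {q : ℕ} (S : Finset (Fin q)) (m : ℕ) : Finset (List (Fin q)) :=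
  (Fintype.piFinset fun _ : Fin m => S).image List.ofFn

lemma card_wordsOver_le {q : ℕ} (S : Finset (Fin q)) (m : ℕ) :
    (wordsOver S m).card ≤ S.card ^ m :=
  Finset.card_image_le.trans (by simp)

lemma mem_wordsOver {q : ℕ} {S : Finset (Fin q)} {v : List (Fin q)} (hv : ∀ a ∈ v, a ∈ S) :
    v ∈ wordsOver S v.length := by
  refine Finset.mem_image.mpr ⟨v.get, ?_, List.ofFn_get v⟩
  simpa [Fintype.mem_piFinset] using fun i : Fin v.length => hv _ (List.get_mem v i)

/-- A code whose codewords share no subsequence of length `a + b` injects into the pairs of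
words over `k₁`- and `k₂`-element alphabets. -/
lemma card_le_of_no_common_subsequence {q n n₁ k₁ k₂ a b : ℕ} (hq : 0 < q)
    (hk₁ : k₁ ≤ q) (hk₂ : k₂ ≤ q) (hn₁ : n₁ ≤ n) (ha : q * a = k₁ * n₁)
    (hb : q * b = k₂ * (n - n₁)) (C : Finset (List (Fin q))) (hlen : ∀ x ∈ C, x.length = n)
    (huniq : ∀ x ∈ C, ∀ y ∈ C, x ≠ y →
      ∀ v : List (Fin q), v.Sublist x → v.Sublist y → v.length < a + b) :
    C.card ≤ 4 ^ q * (k₁ ^ a * k₂ ^ b) := by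
  set T := (Finset.powersetCard k₁ (Finset.univ : Finset (Fin q))) ×ˢ
    (Finset.powersetCard k₂ (Finset.univ : Finset (Fin q))) with hT
  set R := T.biUnion fun p =>
    Finset.image₂ (· ++ ·) (wordsOver p.1 a) (wordsOver p.2 b)
  have hres : ∀ x ∈ C, ∃ v ∈ R, v.Sublist x ∧ v.length = a + b := by
    intro x hx
    obtain ⟨S₁, hS₁, v₁, hv₁, rfl, hm₁⟩ := (x.take n₁).exists_sublist_mem_of_card_eq k₁ a hk₁ hq
      (by rw [ha, List.length_take, hlen x hx, min_eq_left hn₁])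
    obtain ⟨S₂, hS₂, v₂, hv₂, rfl, hm₂⟩ := (x.drop n₁).exists_sublist_mem_of_card_eq k₂ b hk₂ hq
      (by rw [hb, List.length_drop, hlen x hx])
    refine ⟨v₁ ++ v₂, ?_, ?_, List.length_append⟩
    · refine Finset.mem_biUnion.mpr ⟨(S₁, S₂), ?_, ?_⟩
      · simp [hT, Finset.mem_powersetCard, hS₁, hS₂]
      · exact Finset.mem_image₂_of_mem (mem_wordsOver hm₁) (mem_wordsOver hm₂)
    · simpa using hv₁.append hv₂
  choose! r hrR hrx hrl using hres
  have hinj : Set.InjOn r C := by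
    intro x hx y hy hxy
    by_contra hne
    have := huniq x hx y hy hne (r x) (hrx x hx) (hxy ▸ hrx y hy)
    exact this.ne (hrl x hx)
  have hTcard : T.card ≤ 4 ^ q := by
    rw [hT, Finset.card_product, Finset.card_powersetCard, Finset.card_powersetCard,
      Finset.card_univ, Fintype.card_fin, show 4 = 2 * 2 from rfl, mul_pow]
    exact Nat.mul_le_mul (Nat.choose_le_two_pow _ _) (Nat.choose_le_two_pow _ _)
  calc C.card ≤ R.card := Finset.card_le_card_of_injOn r hrR hinj
    _ ≤ T.card * (k₁ ^ a * k₂ ^ b) := by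
        refine Finset.card_biUnion_le_card_mul _ _ _ fun p hp => ?_
        obtain ⟨h₁, h₂⟩ := Finset.mem_product.mp hp
        have hc₁ := card_wordsOver_le p.1 a
        have hc₂ := card_wordsOver_le p.2 b
        rw [(Finset.mem_powersetCard.mp h₁).2] at hc₁
        rw [(Finset.mem_powersetCard.mp h₂).2] at hc₂
        exact (Finset.card_image₂_le _ _ _).trans (Nat.mul_le_mul hc₁ hc₂)
    _ ≤ _ := Nat.mul_le_mul_right _ hTcard

lemma Real.log_two_mul_min_le_negMulLog {y : ℝ} (h0 : 0 < y) (h1 : y ≤ 1) :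
    log 2 * min y (1 - y) ≤ negMulLog y := by
  have hl2 : 0 < log 2 := log_pos one_lt_two
  rcases le_total y (1 / 2) with h | h
  · have hlog : log y ≤ -log 2 := by
      rw [← log_inv]; exact log_le_log h0 (by linarith)
    have := min_le_left y (1 - y)
    rw [negMulLog]
    nlinarith
  · have hc := concaveOn_negMulLog.2 (Set.mem_Ici.mpr zero_le_one)
      (Set.mem_Ici.mpr (by positivity : (0 : ℝ) ≤ 2⁻¹))
      (by linarith : 0 ≤ 2 * y - 1) (by linarith : 0 ≤ 2 - 2 * y) (by ring)
    simp only [smul_eq_mul, negMulLog_one] at hc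
    have hhalf : negMulLog (2⁻¹ : ℝ) = 2⁻¹ * log 2 := by rw [negMulLog, log_inv]; ring
    rw [show (2 * y - 1) * 1 + (2 - 2 * y) * 2⁻¹ = y by ring, hhalf] at hc
    have := min_le_right y (1 - y)
    nlinarith

/-- Piecewise linear interpolation of `x ↦ min x (1 - x)` on the grid `{i / q}` loses at most
the factor `2 / 5`. -/
lemma two_fifths_min_le_interpolation {q d : ℕ} (hd : d + 2 ≤ q) {β : ℝ} (h0 : 0 ≤ β)
    (h1 : β ≤ 1) :
    2 / 5 * min ((d + β) / q) (1 - (d + β) / q) ≤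
      β * min (1 - (d + 1) / q : ℝ) (1 - (1 - (d + 1) / q)) +
        (1 - β) * min (1 - d / q : ℝ) (1 - (1 - d / q)) := by
  have hq : (0 : ℝ) < q := by exact_mod_cast (by omega : 0 < q)
  have hdq : (d : ℝ) + 2 ≤ q := by exact_mod_cast hd
  have hd0 : (0 : ℝ) ≤ d := d.cast_nonneg
  have hscale : ∀ u : ℝ, min (u / q) (1 - u / q) = min u (q - u) / q := fun u => by
    rw [← min_div_div_right hq.le, sub_div, div_self hq.ne']
  simp only [sub_sub_cancel]
  rw [min_comm (1 - (d + 1) / q : ℝ), min_comm (1 - d / q : ℝ), hscale, hscale, hscale,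
    ← mul_div_assoc, ← mul_div_assoc, ← mul_div_assoc, ← add_div]
  refine div_le_div_of_nonneg_right ?_ hq.le
  have hl := min_le_left ((d : ℝ) + β) (q - (d + β))
  have hr := min_le_right ((d : ℝ) + β) (q - (d + β))
  rcases (by omega : 2 * (d + 1) ≤ q ∨ q ≤ 2 * d ∨ (q = 2 * d + 1 ∧ 1 ≤ d)) with h | h | ⟨h, h'⟩
  · have h : 2 * ((d : ℝ) + 1) ≤ q := by exact_mod_cast h
    rw [min_eq_left (by linarith : (d : ℝ) + 1 ≤ q - (d + 1)),
      min_eq_left (by linarith : (d : ℝ) ≤ q - d)]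
    linarith
  · have h : (q : ℝ) ≤ 2 * d := by exact_mod_cast h
    rw [min_eq_right (by linarith : (q : ℝ) - (d + 1) ≤ d + 1),
      min_eq_right (by linarith : (q : ℝ) - d ≤ d)]
    linarith
  · have h : (q : ℝ) = 2 * d + 1 := by exact_mod_cast h
    have h' : (1 : ℝ) ≤ d := by exact_mod_cast h'
    rw [min_eq_right (by linarith : (q : ℝ) - (d + 1) ≤ d + 1),
      min_eq_left (by linarith : (d : ℝ) ≤ q - d)]
    have : β * ((q : ℝ) - (d + 1)) + (1 - β) * d = d := by rw [h]; ring
    linarith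

/-- Concrete form of the paper's Corollary 5, with `f(α) := (2/5)·min(α, 1−α)`.
Let `q ≥ 2`, `0 < α < (q−1)/q`, `d := ⌊qα⌋`, `α' := α − d/q`, and let `n > 0` be such
that `n₁ := qα'n`, `(d+1)n₁/q` and `d(n−n₁)/q` are all integers (so `t := αn` is an
integer). If `q < 2^{f(α)/ε}` for some `ε > 0`, then every code `C ⊆ (Fin q)^n` in
which no two distinct codewords have a common subsequence of length at least `n − αn`
(i.e. `C` is uniquely decodable from `αn` deletions) satisfies
`|C| ≤ 4^q · q^{n(1−α−ε)}`. -/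
theorem stmt_9 (q : ℕ) (hq : 2 ≤ q) (α ε : ℝ) (hα0 : 0 < α)
    (hα1 : α < ((q : ℝ) - 1) / q) (hε : 0 < ε)
    (hqsmall : (q : ℝ) < 2 ^ ((2 / 5 * min α (1 - α)) / ε))
    (n : ℕ) (hn : 0 < n)
    (n₁ t₁ t₂ : ℕ)
    (hn₁ : (n₁ : ℝ) = q * (α - (⌊(q : ℝ) * α⌋₊ : ℝ) / q) * n)
    (ht₁ : (t₁ : ℝ) = ((⌊(q : ℝ) * α⌋₊ : ℝ) + 1) * n₁ / q)
    (ht₂ : (t₂ : ℝ) = (⌊(q : ℝ) * α⌋₊ : ℝ) * ((n : ℝ) - n₁) / q)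
    (t : ℕ) (ht : (t : ℝ) = α * n)
    (C : Finset (List (Fin q))) (hlen : ∀ x ∈ C, x.length = n)
    (huniq : ∀ x ∈ C, ∀ y ∈ C, x ≠ y →
      ∀ v : List (Fin q), v.Sublist x → v.Sublist y → v.length < n - t) :
    (C.card : ℝ) ≤ 4 ^ q * (q : ℝ) ^ ((n : ℝ) * (1 - α - ε)) := by
  have hq0 : (0 : ℝ) < q := by exact_mod_cast (by omega : 0 < q)
  have hn0 : (0 : ℝ) < n := by exact_mod_cast hn
  have hl2 : 0 < log 2 := log_pos one_lt_two
  have hqα : (q : ℝ) * α < q - 1 := by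
    rw [lt_div_iff₀ hq0] at hα1; linarith
  have hfl := Nat.floor_le (mul_nonneg hq0.le hα0.le)
  have hlt := Nat.lt_floor_add_one ((q : ℝ) * α)
  set d := ⌊(q : ℝ) * α⌋₊
  have hd : d + 2 ≤ q := by
    have : (d : ℝ) + 1 < q := by linarith
    have : d + 1 < q := by exact_mod_cast this
    omega
  obtain ⟨β, hβ⟩ : ∃ β : ℝ, β = q * α - d := ⟨_, rfl⟩
  have hβ0 : 0 ≤ β := by linarith
  have hβ1 : β ≤ 1 := by linarith
  have hα : α = (d + β) / q := by rw [hβ]; field_simp; ring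
  have hn₁' : (n₁ : ℝ) = β * n := by rw [hn₁, hβ]; field_simp
  have hn₁n : n₁ ≤ n := by
    have : (n₁ : ℝ) ≤ n := by nlinarith
    exact_mod_cast this
  have ht₁' : q * t₁ = (d + 1) * n₁ := by
    rw [eq_div_iff hq0.ne'] at ht₁
    have : (q : ℝ) * t₁ = (d + 1) * n₁ := by linarith
    exact_mod_cast this
  have ht₂' : q * t₂ = d * (n - n₁) := by
    rw [eq_div_iff hq0.ne', ← Nat.cast_sub hn₁n] at ht₂
    have : (q : ℝ) * t₂ = d * (n - n₁ : ℕ) := by linarith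
    exact_mod_cast this
  have hle₁ : t₁ ≤ n₁ := by
    refine Nat.le_of_mul_le_mul_left (c := q) ?_ (by omega)
    rw [ht₁']; exact Nat.mul_le_mul_right _ (by omega)
  have hle₂ : t₂ ≤ n - n₁ := by
    refine Nat.le_of_mul_le_mul_left (c := q) ?_ (by omega)
    rw [ht₂']; exact Nat.mul_le_mul_right _ (by omega)
  have htt : t = t₁ + t₂ := by
    have : (t : ℝ) = t₁ + t₂ := by
      rw [ht, ht₁, ht₂, hn₁', hα]; field_simp; ring
    exact_mod_cast this
  obtain ⟨a, ha⟩ := Nat.exists_eq_add_of_le hle₁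
  obtain ⟨b, hb⟩ := Nat.exists_eq_add_of_le hle₂
  obtain ⟨k, hk⟩ := Nat.exists_eq_add_of_le hd
  have hqa : q * a = (k + 1) * n₁ := by
    have : q * n₁ = q * t₁ + q * a := by rw [ha]; ring
    rw [ht₁'] at this; rw [hk] at this ⊢; nlinarith
  have hqb : q * b = (k + 2) * (n - n₁) := by
    have : q * (n - n₁) = q * t₂ + q * b := by rw [hb]; ring
    rw [ht₂'] at this; rw [hk] at this ⊢; nlinarith
  have hcard := card_le_of_no_common_subsequence (by omega) (by omega) (by omega) hn₁n hqa hqb C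
    hlen fun x hx y hy hxy v hvx hvy => by
      have := huniq x hx y hy hxy v hvx hvy
      omega
  have hkq : (q : ℝ) = d + 2 + k := by exact_mod_cast hk
  have hk0 : (0 : ℝ) ≤ k := k.cast_nonneg
  have hd0 : (0 : ℝ) ≤ d := d.cast_nonneg
  set y₁ : ℝ := 1 - (d + 1) / q with hy₁
  set y₀ : ℝ := 1 - d / q with hy₀
  have hqy₁ : (k : ℝ) + 1 = q * y₁ := by rw [hy₁]; field_simp; linarith
  have hqy₀ : (k : ℝ) + 2 = q * y₀ := by rw [hy₀]; field_simp; linarith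
  have hy₁0 : 0 < y₁ := pos_of_mul_pos_right (by linarith) hq0.le
  have hy₀0 : 0 < y₀ := pos_of_mul_pos_right (by linarith) hq0.le
  have hy₁1 : y₁ ≤ 1 := by
    have : (0 : ℝ) ≤ (d + 1) / q := by positivity
    linarith
  have hy₀1 : y₀ ≤ 1 := by
    have : (0 : ℝ) ≤ d / q := by positivity
    linarith
  have haR : (a : ℝ) = y₁ * (β * n) := by
    have : (q : ℝ) * a = (k + 1) * n₁ := by exact_mod_cast hqa
    rw [hqy₁, hn₁', mul_assoc] at this
    exact mul_left_cancel₀ hq0.ne' this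
  have hbR : (b : ℝ) = y₀ * ((1 - β) * n) := by
    have : (q : ℝ) * b = (k + 2) * (n - n₁ : ℕ) := by exact_mod_cast hqb
    rw [hqy₀, Nat.cast_sub hn₁n, hn₁', mul_assoc] at this
    rw [mul_left_cancel₀ hq0.ne' this]; ring
  have hεlog : ε * log q ≤ log 2 * (2 / 5 * min α (1 - α)) := by
    have := log_lt_log hq0 hqsmall
    rw [log_rpow two_pos, div_mul_eq_mul_div, lt_div_iff₀ hε] at this
    linarith
  have hentropy : ε * log q ≤ β * negMulLog y₁ + (1 - β) * negMulLog y₀ := by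
    have hinterp := two_fifths_min_le_interpolation hd hβ0 hβ1
    rw [← hα, ← hy₁, ← hy₀] at hinterp
    have e₁ := mul_le_mul_of_nonneg_left (log_two_mul_min_le_negMulLog hy₁0 hy₁1) hβ0
    have e₀ := mul_le_mul_of_nonneg_left (log_two_mul_min_le_negMulLog hy₀0 hy₀1)
      (sub_nonneg.mpr hβ1)
    have := mul_le_mul_of_nonneg_left hinterp hl2.le
    linarith
  have hsum : y₁ * β + y₀ * (1 - β) = 1 - α := by
    rw [hy₁, hy₀, hα]; field_simp; ring
  have hpow : ((k : ℝ) + 1) ^ a * ((k : ℝ) + 2) ^ b ≤ (q : ℝ) ^ ((n : ℝ) * (1 - α - ε)) := by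
    rw [hqy₁, hqy₀]
    refine (log_le_log_iff (by positivity) (by positivity)).mp ?_
    rw [log_mul (by positivity) (by positivity), log_pow, log_pow, log_rpow hq0,
      log_mul hq0.ne' hy₁0.ne', log_mul hq0.ne' hy₀0.ne', haR, hbR]
    have := mul_le_mul_of_nonneg_left hentropy hn0.le
    rw [negMulLog, negMulLog] at this
    rw [← hsum]
    linarith
  calc (C.card : ℝ) ≤ 4 ^ q * (((k : ℝ) + 1) ^ a * ((k : ℝ) + 2) ^ b) := by exact_mod_cast hcard
    _ ≤ _ := by gcongr
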